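/- If there exists an ((n,K,R,d))_q Clifford subsystem code with K > 1, then there exists an ((n+1, K, R, d'))_q Clifford subsystem code with d' ≥ d that is pure to 1; explicitly, if C ≤ F_q^{2n} is the associated additive code, then the additive code C' = {(aα | b0) : (a|b) ∈ C, α ∈ F_q} ≤ F_q^{2(n+1)} defines such a code. -/

import Mathlib

open scoped BigOperators

/-- The symplectic weight of a vector `(x|y) ∈ F_q^n × F_q^n`: the number of
coordinates `i` with `(x_i, y_i) ≠ (0,0)`. -/
noncomputable def swt {F : Type*} [Field F] {n : ℕ} (v : (Fin n → F) × (Fin n → F)) : ℕ :=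
  Nat.card {i : Fin n // ¬(v.1 i = 0 ∧ v.2 i = 0)}

/-- The minimum symplectic weight of the nonzero elements of a set `X`. -/
noncomputable def minSwt {F : Type*} [Field F] {n : ℕ}
    (X : Set ((Fin n → F) × (Fin n → F))) : ℕ :=
  sInf (swt '' {v ∈ X | v ≠ 0})

/-- The trace-symplectic form `⟨(a|b)|(a'|b')⟩ₛ = Tr_{F_q/F_p}(a'·b − a·b')`. -/
noncomputable def traceSymp (p : ℕ) {F : Type*} [Field F] [Algebra (ZMod p) F] {n : ℕ}
    (u w : (Fin n → F) × (Fin n → F)) : ZMod p :=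
  Algebra.trace (ZMod p) F (∑ i, (w.1 i * u.2 i - u.1 i * w.2 i))

/-- The trace-symplectic dual of a set `C ⊆ F_q^{2n}`. -/
def sdual (p : ℕ) {F : Type*} [Field F] [Algebra (ZMod p) F] {n : ℕ}
    (C : Set ((Fin n → F) × (Fin n → F))) : Set ((Fin n → F) × (Fin n → F)) :=
  {v | ∀ w ∈ C, traceSymp p v w = 0}

/-- `C` is (the additive code associated with) an `((n,K,R,d))_q` Clifford subsystem code:
with `D = C ∩ C^⊥s`, `|C| = q^n R / K`, `|D| = q^n/(KR)`, and `d = swt(D^⊥s − C)` if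
`C ≠ D^⊥s`, else `d = swt(D^⊥s)`. -/
def IsSubsysCode (p : ℕ) {F : Type*} [Field F] [Fintype F] [Algebra (ZMod p) F] {n : ℕ}
    (K R d : ℕ) (C : AddSubgroup ((Fin n → F) × (Fin n → F))) : Prop :=
  let S : Set ((Fin n → F) × (Fin n → F)) := ↑C
  let D : Set ((Fin n → F) × (Fin n → F)) := S ∩ sdual p S
  let Dp : Set ((Fin n → F) × (Fin n → F)) := sdual p D
  K * Nat.card C = Fintype.card F ^ n * R ∧
  K * R * Nat.card D = Fintype.card F ^ n ∧
  (S = Dp → d = minSwt Dp) ∧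
  (S ≠ Dp → d = minSwt (Dp \ S))

/-- `C` is (the linear code associated with) an `F_q`-linear `[[n,k,r,d]]_q` subsystem code. -/
def IsLinSubsysCode (p : ℕ) {F : Type*} [Field F] [Fintype F] [Algebra (ZMod p) F] {n : ℕ}
    (k r d : ℕ) (C : Submodule F ((Fin n → F) × (Fin n → F))) : Prop :=
  IsSubsysCode p (Fintype.card F ^ k) (Fintype.card F ^ r) d C.toAddSubgroup

/-- The lengthening `X' = {(aα|b0) : (a|b) ∈ X, α ∈ F_q}` of a set `X ⊆ F_q^{2n}`. -/
def extendSet {F : Type*} [Field F] {n : ℕ}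
    (X : Set ((Fin n → F) × (Fin n → F))) :
    Set ((Fin (n + 1) → F) × (Fin (n + 1) → F)) :=
  {v | ∃ w ∈ X, ∃ α : F, v = (Fin.snoc w.1 α, Fin.snoc w.2 0)}

/-- The lengthening of an additive code `C ≤ F_q^{2n}`, as an additive code in `F_q^{2(n+1)}`. -/
def extendCode {F : Type*} [Field F] {n : ℕ}
    (C : AddSubgroup ((Fin n → F) × (Fin n → F))) :
    AddSubgroup ((Fin (n + 1) → F) × (Fin (n + 1) → F)) where
  carrier := extendSet (C : Set ((Fin n → F) × (Fin n → F)))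
  zero_mem' := ⟨0, C.zero_mem, 0, by
    refine Prod.ext ?_ ?_ <;>
      · funext i; refine Fin.lastCases ?_ ?_ i <;> simp⟩
  add_mem' := by
    rintro a b ⟨w, hw, α, rfl⟩ ⟨w', hw', α', rfl⟩
    refine ⟨w + w', C.add_mem hw hw', α + α', ?_⟩
    refine Prod.ext ?_ ?_ <;>
      · funext i; refine Fin.lastCases ?_ ?_ i <;> simp
  neg_mem' := by
    rintro a ⟨w, hw, α, rfl⟩
    refine ⟨-w, C.neg_mem hw, -α, ?_⟩
    refine Prod.ext ?_ ?_ <;>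
      · funext i; refine Fin.lastCases ?_ ?_ i <;> simp

section SymplecticDuality

variable {p : ℕ} {F : Type*} [Field F] [Algebra (ZMod p) F] {n : ℕ}

theorem traceSymp_swap (u w : (Fin n → F) × (Fin n → F)) :
    traceSymp p w u = -traceSymp p u w := by
  unfold traceSymp
  rw [← map_neg, ← Finset.sum_neg_distrib]
  congr 1
  exact Finset.sum_congr rfl fun i _ => by ring

theorem traceSymp_add_left (u u' w : (Fin n → F) × (Fin n → F)) :
    traceSymp p (u + u') w = traceSymp p u w + traceSymp p u' w := by
  unfold traceSymp
  rw [← map_add, ← Finset.sum_add_distrib]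
  congr 1
  exact Finset.sum_congr rfl fun i _ => by simp only [Prod.fst_add, Prod.snd_add, Pi.add_apply]; ring

theorem traceSymp_smul_left (c : ZMod p) (u w : (Fin n → F) × (Fin n → F)) :
    traceSymp p (c • u) w = c * traceSymp p u w := by
  unfold traceSymp
  rw [← smul_eq_mul, ← map_smul, Finset.smul_sum]
  congr 1
  refine Finset.sum_congr rfl fun i _ => ?_
  simp only [Prod.smul_fst, Prod.smul_snd, Pi.smul_apply, smul_sub, mul_smul_comm,
    smul_mul_assoc]

variable (p F n) in
/-- The trace-symplectic form as a bilinear form over `ZMod p`. -/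
noncomputable def traceSympBilin :
    ((Fin n → F) × (Fin n → F)) →ₗ[ZMod p] ((Fin n → F) × (Fin n → F)) →ₗ[ZMod p] ZMod p :=
  LinearMap.mk₂ (ZMod p) (traceSymp p) traceSymp_add_left traceSymp_smul_left
    (fun u w w' => by
      rw [traceSymp_swap, traceSymp_add_left, traceSymp_swap u w, traceSymp_swap u w']; ring)
    (fun c u w => by
      rw [traceSymp_swap, traceSymp_smul_left, traceSymp_swap u w, smul_eq_mul]; ring)

/-- The trace-symplectic dual of a set, as an additive subgroup. -/
def sdualAddSubgroup (X : Set ((Fin n → F) × (Fin n → F))) :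
    AddSubgroup ((Fin n → F) × (Fin n → F)) where
  carrier := sdual p X
  zero_mem' := fun w _ => LinearMap.map_zero₂ (traceSympBilin p F n) w
  add_mem' := fun ha hb w hw => by rw [traceSymp_add_left, ha w hw, hb w hw, add_zero]
  neg_mem' := fun {a} ha w hw => by
    have h := LinearMap.map_neg₂ (traceSympBilin p F n) a w
    exact h.trans (neg_eq_zero.mpr (ha w hw))

theorem card_le_card_mul_card_sdual [Fact p.Prime] [Fintype F]
    (D : AddSubgroup ((Fin n → F) × (Fin n → F))) :
    Fintype.card F ^ n * Fintype.card F ^ n ≤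
      Nat.card D * Nat.card (sdual p (D : Set ((Fin n → F) × (Fin n → F)))) := by
  let E : Submodule (ZMod p) ((Fin n → F) × (Fin n → F)) := AddSubgroup.toZModSubmodule p D
  let g : ((Fin n → F) × (Fin n → F)) →ₗ[ZMod p] Module.Dual (ZMod p) E :=
    E.subtype.dualMap ∘ₗ traceSympBilin p F n
  have hker : (LinearMap.ker g : Set ((Fin n → F) × (Fin n → F))) = sdual p D := by
    ext v
    simp only [SetLike.mem_coe, LinearMap.mem_ker, sdual, Set.mem_ofPred_eq]
    constructor
    · intro h w hw
      exact LinearMap.congr_fun h (⟨w, hw⟩ : E)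
    · intro h
      exact LinearMap.ext fun w => h w w.2
  have hrank := g.finrank_range_add_finrank_ker
  have hle : Module.finrank (ZMod p) (LinearMap.range g) ≤ Module.finrank (ZMod p) E :=
    (Submodule.finrank_le _).trans_eq Subspace.dual_finrank_eq
  have hV : Nat.card ((Fin n → F) × (Fin n → F)) = Fintype.card F ^ n * Fintype.card F ^ n := by
    simp [Nat.card_eq_fintype_card]
  have hE : Nat.card E = Nat.card D := rfl
  have hK : Nat.card (LinearMap.ker g) = Nat.card (sdual p (D : Set ((Fin n → F) × (Fin n → F)))) := by
    rw [← hker]; rfl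
  have hp : 1 ≤ p := (Fact.out : p.Prime).one_le
  rw [← hV, ← hE, ← hK, Module.natCard_eq_pow_finrank (K := ZMod p),
    Module.natCard_eq_pow_finrank (K := ZMod p) (V := E),
    Module.natCard_eq_pow_finrank (K := ZMod p) (V := LinearMap.ker g), Nat.card_zmod, ← pow_add]
  exact Nat.pow_le_pow_right hp (by omega)

theorem subset_sdual_inter_sdual (S : Set ((Fin n → F) × (Fin n → F))) :
    S ⊆ sdual p (S ∩ sdual p S) := fun v hv w hw => by
  rw [traceSymp_swap, hw.2 v hv, neg_zero]

end SymplecticDuality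

section Lengthening

theorem exists_eq_snoc {F : Type*} {n : ℕ} (v : (Fin (n + 1) → F) × (Fin (n + 1) → F)) :
    ∃ (a b : Fin n → F) (α β : F), v = (Fin.snoc a α, Fin.snoc b β) :=
  ⟨Fin.init v.1, Fin.init v.2, v.1 (Fin.last n), v.2 (Fin.last n), by
    rw [Fin.snoc_init_self, Fin.snoc_init_self]⟩

variable {F : Type*} [Field F] {n : ℕ}

theorem snoc_mem_extendSet {X : Set ((Fin n → F) × (Fin n → F))} {a b : Fin n → F} {α β : F} :
    ((Fin.snoc a α, Fin.snoc b β) : (Fin (n + 1) → F) × (Fin (n + 1) → F)) ∈ extendSet X ↔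
      (a, b) ∈ X ∧ β = 0 := by
  constructor
  · rintro ⟨w, hw, γ, h⟩
    obtain ⟨h₁, h₂⟩ := Prod.mk.inj h
    obtain ⟨ha, -⟩ := Fin.snoc_injective2 h₁
    obtain ⟨hb, hβ⟩ := Fin.snoc_injective2 h₂
    subst ha hb
    exact ⟨hw, hβ⟩
  · rintro ⟨h, rfl⟩
    exact ⟨(a, b), h, α, rfl⟩

theorem extendSet_inter (X Y : Set ((Fin n → F) × (Fin n → F))) :
    extendSet (X ∩ Y) = extendSet X ∩ extendSet Y := by
  ext v
  obtain ⟨a, b, α, β, rfl⟩ := exists_eq_snoc v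
  simp only [Set.mem_inter_iff, snoc_mem_extendSet]
  tauto

theorem extendSet_diff (X Y : Set ((Fin n → F) × (Fin n → F))) :
    extendSet (X \ Y) = extendSet X \ extendSet Y := by
  ext v
  obtain ⟨a, b, α, β, rfl⟩ := exists_eq_snoc v
  simp only [Set.mem_sdiff, snoc_mem_extendSet]
  tauto

theorem extendSet_injective :
    Function.Injective (extendSet : Set ((Fin n → F) × (Fin n → F)) → _) := by
  intro X Y h
  ext ⟨a, b⟩
  have h' := Set.ext_iff.mp h (Fin.snoc a 0, Fin.snoc b 0)
  simpa only [snoc_mem_extendSet, and_true] using h'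

theorem natCard_extendSet [Fintype F] (X : Set ((Fin n → F) × (Fin n → F))) :
    Nat.card (extendSet X) = Fintype.card F * Nat.card X := by
  have e : F × X ≃ extendSet X := Equiv.ofBijective
    (fun t => ⟨(Fin.snoc t.2.1.1 t.1, Fin.snoc t.2.1.2 0), t.2.1, t.2.2, t.1, rfl⟩) <| by
      constructor
      · rintro ⟨α, ⟨⟨a, b⟩, h⟩⟩ ⟨α', ⟨⟨a', b'⟩, h'⟩⟩ ht
        obtain ⟨h₁, h₂⟩ := Prod.mk.inj (Subtype.mk.inj ht)
        obtain ⟨rfl, rfl⟩ := Fin.snoc_injective2 h₁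
        obtain ⟨rfl, -⟩ := Fin.snoc_injective2 h₂
        rfl
      · rintro ⟨v, w, hw, α, rfl⟩
        exact ⟨(α, ⟨w, hw⟩), rfl⟩
  rw [← Nat.card_congr e, Nat.card_prod, Nat.card_eq_fintype_card]

theorem traceSymp_snoc (p : ℕ) [Algebra (ZMod p) F] (a b a' b' : Fin n → F) (α β α' β' : F) :
    traceSymp p ((Fin.snoc a α, Fin.snoc b β) : (Fin (n + 1) → F) × (Fin (n + 1) → F))
      (Fin.snoc a' α', Fin.snoc b' β') =
      traceSymp p (a, b) (a', b') + Algebra.trace (ZMod p) F (α' * β - α * β') := by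
  simp only [traceSymp, Fin.sum_univ_castSucc, Fin.snoc_castSucc, Fin.snoc_last, map_add]

theorem sdual_extendSet (p : ℕ) [Fact p.Prime] [Finite F] [Algebra (ZMod p) F]
    {X : Set ((Fin n → F) × (Fin n → F))} (h0 : (0 : (Fin n → F) × (Fin n → F)) ∈ X) :
    sdual p (extendSet X) = extendSet (sdual p X) := by
  ext v
  obtain ⟨a, b, α, β, rfl⟩ := exists_eq_snoc v
  rw [snoc_mem_extendSet]
  constructor
  · intro h
    refine ⟨fun w hw => ?_, ?_⟩
    · have := h (Fin.snoc w.1 0, Fin.snoc w.2 0) ⟨w, hw, 0, rfl⟩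
      rw [traceSymp_snoc] at this
      simpa using this
    · refine (traceForm_nondegenerate (ZMod p) F).1 β fun γ => ?_
      have := h (Fin.snoc 0 γ, Fin.snoc 0 0) ⟨0, h0, γ, rfl⟩
      rw [traceSymp_snoc] at this
      simpa [traceSymp, Algebra.traceForm_apply, mul_comm] using this
  · rintro ⟨h, rfl⟩ _ ⟨w, hw, γ, rfl⟩
    rw [traceSymp_snoc, h w hw]
    simp

theorem swt_pos {v : (Fin n → F) × (Fin n → F)} (hv : v ≠ 0) : 1 ≤ swt v := by
  by_contra! h
  have hempty : IsEmpty {i : Fin n // ¬(v.1 i = 0 ∧ v.2 i = 0)} :=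
    (Nat.card_eq_zero.mp (Nat.lt_one_iff.mp h)).resolve_right (fun hi => hi.not_finite inferInstance)
  refine hv (Prod.ext (funext fun i => ?_) (funext fun i => ?_)) <;>
    · by_contra hi
      exact hempty.false ⟨i, fun h => hi (by simp [h.1, h.2])⟩

theorem swt_le_swt_snoc (w : (Fin n → F) × (Fin n → F)) (α β : F) :
    swt w ≤ swt ((Fin.snoc w.1 α, Fin.snoc w.2 β) : (Fin (n + 1) → F) × (Fin (n + 1) → F)) := by
  refine Nat.card_le_card_of_injective (fun i => ⟨i.1.castSucc, by simpa using i.2⟩) ?_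
  intro i j h
  exact Subtype.ext (Fin.castSucc_injective n (Subtype.mk.inj h))

theorem minSwt_le_swt {X : Set ((Fin n → F) × (Fin n → F))} {v : (Fin n → F) × (Fin n → F)}
    (hv : v ∈ X) (h0 : v ≠ 0) : minSwt X ≤ swt v :=
  Nat.sInf_le ⟨v, ⟨hv, h0⟩, rfl⟩

theorem le_minSwt {X : Set ((Fin n → F) × (Fin n → F))} {k : ℕ} (hX : ∃ v ∈ X, v ≠ 0)
    (h : ∀ v ∈ X, v ≠ 0 → k ≤ swt v) : k ≤ minSwt X := by
  obtain ⟨v, hv, hv0⟩ := hX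
  refine le_csInf ⟨swt v, v, ⟨hv, hv0⟩, rfl⟩ ?_
  rintro _ ⟨w, ⟨hw, hw0⟩, rfl⟩
  exact h w hw hw0

theorem snoc_ne_zero {w : (Fin n → F) × (Fin n → F)} (hw : w ≠ 0) (α β : F) :
    ((Fin.snoc w.1 α, Fin.snoc w.2 β) : (Fin (n + 1) → F) × (Fin (n + 1) → F)) ≠ 0 := by
  contrapose! hw
  refine Prod.ext (funext fun i => ?_) (funext fun i => ?_)
  · simpa using congrFun (congrArg Prod.fst hw) i.castSucc
  · simpa using congrFun (congrArg Prod.snd hw) i.castSucc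

theorem minSwt_le_minSwt_extendSet {X : Set ((Fin n → F) × (Fin n → F))} (hX : X.Nonempty)
    (h0 : (0 : (Fin n → F) × (Fin n → F)) ∉ X) : minSwt X ≤ minSwt (extendSet X) := by
  have hne : ∀ w ∈ X, w ≠ 0 := fun w hw h => h0 (h ▸ hw)
  obtain ⟨w, hw⟩ := hX
  refine le_minSwt ⟨_, ⟨w, hw, 0, rfl⟩, snoc_ne_zero (hne w hw) 0 0⟩ ?_
  rintro _ ⟨u, hu, α, rfl⟩ -
  exact (minSwt_le_swt hu (hne u hu)).trans (swt_le_swt_snoc u α 0)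

theorem one_le_minSwt_extendSet {X : Set ((Fin n → F) × (Fin n → F))} (hX : X.Nonempty) :
    1 ≤ minSwt (extendSet X) := by
  obtain ⟨w, hw⟩ := hX
  refine le_minSwt ⟨_, ⟨w, hw, 1, rfl⟩, fun h => ?_⟩ fun v _ hv => swt_pos hv
  simpa using congrFun (congrArg Prod.fst h) (Fin.last n)

end Lengthening

/-- A subsystem code with `K > 1` is strictly smaller than the dual of its stabilizer `C ∩ C^⊥s`. -/
theorem IsSubsysCode.ne_sdual {p : ℕ} [Fact p.Prime] {F : Type*} [Field F] [Fintype F]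
    [Algebra (ZMod p) F] {n K R d : ℕ} {C : AddSubgroup ((Fin n → F) × (Fin n → F))}
    (hC : IsSubsysCode p K R d C) (hK : 1 < K) :
    (C : Set ((Fin n → F) × (Fin n → F))) ≠ sdual p (C ∩ sdual p C) := by
  obtain ⟨h₁, h₂, -⟩ := hC
  intro h
  have hle := card_le_card_mul_card_sdual (p := p) (C ⊓ sdualAddSubgroup (p := p) C)
  have hdual : Nat.card (sdual p
      ((C ⊓ sdualAddSubgroup (p := p) C : AddSubgroup _) : Set ((Fin n → F) × (Fin n → F)))) =
      Nat.card C := by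
    change Nat.card (sdual p ((C : Set ((Fin n → F) × (Fin n → F))) ∩ sdual p C)) = _
    rw [← h]
    rfl
  rw [hdual] at hle
  change _ ≤ Nat.card ((C : Set ((Fin n → F) × (Fin n → F))) ∩ sdual p C : Set _) * _ at hle
  have hq : 0 < Fintype.card F ^ n := pow_pos Fintype.card_pos n
  generalize Nat.card ((C : Set ((Fin n → F) × (Fin n → F))) ∩ sdual p C : Set _) = x at h₂ hle
  generalize Nat.card C = y at h₁ hle
  generalize Fintype.card F ^ n = Q at h₁ h₂ hle hq
  have hR : 0 < R := by
    rcases Nat.eq_zero_or_pos R with rfl | hR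
    · simp at h₂; omega
    · exact hR
  have hprod : K * K * (x * y) = Q * Q := by
    refine Nat.eq_of_mul_eq_mul_left hR ?_
    calc R * (K * K * (x * y)) = (K * R * x) * (K * y) := by ring
      _ = R * (Q * Q) := by rw [h₁, h₂]; ring
  have hQ : 0 < Q * Q := Nat.mul_pos hq hq
  have hKK : 4 ≤ K * K := Nat.mul_le_mul hK hK
  nlinarith [Nat.mul_le_mul hKK hle]

/-- Lengthening: if `C` is the additive code of an `((n,K,R,d))_q` subsystem
code with `K > 1`, then the code `C' = {(aα|b0) : (a|b) ∈ C, α ∈ F_q}` defines an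
`((n+1,K,R,d''))_q` subsystem code with `d'' ≥ d` that is pure to `1`. -/
theorem stmt_12 (p m n : ℕ) [Fact p.Prime] (hm : 0 < m)
    (F : Type) [Field F] [Fintype F] [Algebra (ZMod p) F]
    (hq : Fintype.card F = p ^ m) (K R d : ℕ)
    (C : AddSubgroup ((Fin n → F) × (Fin n → F)))
    (hC : IsSubsysCode p K R d C) (hK : 1 < K) :
    ∃ d'', d ≤ d'' ∧ IsSubsysCode p K R d'' (extendCode C) ∧
      1 ≤ minSwt ((extendCode C : Set ((Fin (n + 1) → F) × (Fin (n + 1) → F)))) := by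
  have hne := hC.ne_sdual hK
  obtain ⟨h₁, h₂, -, h₄⟩ := hC
  have hd := h₄ hne
  set S : Set ((Fin n → F) × (Fin n → F)) := ↑C with hS
  have h0 : (0 : (Fin n → F) × (Fin n → F)) ∈ S := C.zero_mem
  have h0' : (0 : (Fin n → F) × (Fin n → F)) ∈ S ∩ sdual p S :=
    ⟨h0, (sdualAddSubgroup (p := p) S).zero_mem⟩
  have hS' : ((extendCode C : AddSubgroup _) : Set ((Fin (n + 1) → F) × (Fin (n + 1) → F))) =
      extendSet S := rfl
  have hD : extendSet S ∩ sdual p (extendSet S) = extendSet (S ∩ sdual p S) := by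
    rw [sdual_extendSet p h0, extendSet_inter]
  have hDp : sdual p (extendSet (S ∩ sdual p S)) = extendSet (sdual p (S ∩ sdual p S)) :=
    sdual_extendSet p h0'
  refine ⟨minSwt (extendSet (sdual p (S ∩ sdual p S) \ S)), ?_, ⟨?_, ?_, ?_, ?_⟩, ?_⟩
  · rw [hd]
    exact minSwt_le_minSwt_extendSet
      (Set.nonempty_of_ssubset ((subset_sdual_inter_sdual S).ssubset_of_ne hne)) fun h => h.2 h0
  · change K * Nat.card (extendSet S) = _
    rw [natCard_extendSet, pow_succ]
    change K * (_ * Nat.card C) = _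
    rw [mul_left_comm, h₁]
    ring
  · rw [hS', hD, natCard_extendSet, mul_left_comm, h₂, pow_succ, mul_comm]
  · rw [hS', hD, hDp]
    exact fun h => absurd (extendSet_injective h) hne
  · rw [hS', hD, hDp, extendSet_diff]
    exact fun _ => rfl
  · exact one_le_minSwt_extendSet ⟨0, h0⟩
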